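/- Every Dirichlet eigenvalue of the open equilateral triangle E with vertices (0,0), (1,0), (1/2, √3/2) is of the form (4π/3)²·(j² + k² + jk) for some positive integers j and k. That is, if u : ℝ² → ℝ is continuous on the closure of E, twice continuously differentiable on E, vanishes on the boundary ∂E, is not identically zero on E, and satisfies ∂²u/∂x² + ∂²u/∂y² = −λ·u at every point of E, then there exist positive integers j, k with λ = (4π/3)²(j² + k² + jk). -/

import Mathlib

/-- The planar Laplacian `∂²u/∂x² + ∂²u/∂y²` of `u : ℝ × ℝ → ℝ` at a point `p`. -/
noncomputable def lap2 (u : ℝ × ℝ → ℝ) (p : ℝ × ℝ) : ℝ :=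
  deriv (deriv fun x => u (x, p.2)) p.1 + deriv (deriv fun y => u (p.1, y)) p.2

/-- The open equilateral triangle with vertices `(0,0)`, `(1,0)`, `(1/2, √3/2)`. -/
noncomputable def equilateralTriangle : Set (ℝ × ℝ) :=
  interior (convexHull ℝ {((0 : ℝ), (0 : ℝ)), ((1 : ℝ), (0 : ℝ)),
    ((1 / 2 : ℝ), (Real.sqrt 3 / 2 : ℝ))})

open MeasureTheory Filter Topology Set

/-- closed triangle, by inequalities -/
def Ktri : Set (ℝ × ℝ) :=
  {p | 0 ≤ p.2 ∧ p.2 ≤ Real.sqrt 3 * p.1 ∧ p.2 ≤ Real.sqrt 3 * (1 - p.1)}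

/-- open triangle, by inequalities -/
def Etri : Set (ℝ × ℝ) :=
  {p | 0 < p.2 ∧ p.2 < Real.sqrt 3 * p.1 ∧ p.2 < Real.sqrt 3 * (1 - p.1)}

lemma s3pos : 0 < Real.sqrt 3 := by positivity

lemma s3sq : Real.sqrt 3 * Real.sqrt 3 = 3 := Real.mul_self_sqrt (by norm_num)

lemma isOpen_Etri : IsOpen Etri := by
  have h1 : IsOpen {p : ℝ × ℝ | 0 < p.2} := isOpen_lt (by fun_prop) (by fun_prop)
  have h2 : IsOpen {p : ℝ × ℝ | p.2 < Real.sqrt 3 * p.1} := isOpen_lt (by fun_prop) (by fun_prop)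
  have h3 : IsOpen {p : ℝ × ℝ | p.2 < Real.sqrt 3 * (1 - p.1)} :=
    isOpen_lt (by fun_prop) (by fun_prop)
  convert h1.inter (h2.inter h3) using 1
  rfl

lemma isClosed_Ktri : IsClosed Ktri := by
  have h1 : IsClosed {p : ℝ × ℝ | 0 ≤ p.2} := isClosed_le (by fun_prop) (by fun_prop)
  have h2 : IsClosed {p : ℝ × ℝ | p.2 ≤ Real.sqrt 3 * p.1} :=
    isClosed_le (by fun_prop) (by fun_prop)
  have h3 : IsClosed {p : ℝ × ℝ | p.2 ≤ Real.sqrt 3 * (1 - p.1)} :=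
    isClosed_le (by fun_prop) (by fun_prop)
  convert h1.inter (h2.inter h3) using 1
  rfl

lemma Etri_sub_Ktri : Etri ⊆ Ktri := fun _ h => ⟨h.1.le, h.2.1.le, h.2.2.le⟩

lemma convex_Ktri : Convex ℝ Ktri := by
  rintro ⟨x, y⟩ ⟨h1, h2, h3⟩ ⟨x', y'⟩ ⟨h1', h2', h3'⟩ a b ha hb hab
  simp only [Ktri, mem_ofPred_eq, Prod.smul_mk, Prod.mk_add_mk, smul_eq_mul] at *
  refine ⟨by positivity, ?_, ?_⟩
  · nlinarith [mul_le_mul_of_nonneg_left h2 ha, mul_le_mul_of_nonneg_left h2' hb]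
  · have : b = 1 - a := by linarith
    subst this
    nlinarith [mul_le_mul_of_nonneg_left h3 ha, mul_le_mul_of_nonneg_left h3' hb]

lemma Ktri_bounds {p : ℝ × ℝ} (hp : p ∈ Ktri) :
    0 ≤ p.1 ∧ p.1 ≤ 1 ∧ 0 ≤ p.2 ∧ p.2 ≤ 1 := by
  obtain ⟨h1, h2, h3⟩ := hp
  have hs := s3pos
  have hsq := s3sq
  have : Real.sqrt 3 ≤ 2 := by nlinarith
  have a : 0 ≤ p.1 := by
    by_contra h; push Not at h; nlinarith
  have b : p.1 ≤ 1 := by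
    by_contra h; push Not at h; nlinarith
  exact ⟨a, b, h1, by nlinarith⟩

lemma isCompact_Ktri : IsCompact Ktri := by
  refine (isCompact_Icc (a := ((0:ℝ),(0:ℝ))) (b := ((1:ℝ),(1:ℝ)))).of_isClosed_subset
    isClosed_Ktri ?_
  intro p hp
  obtain ⟨a, b, c, d⟩ := Ktri_bounds hp
  exact ⟨⟨a, c⟩, ⟨b, d⟩⟩

lemma hull_sub_Ktri : convexHull ℝ {((0 : ℝ), (0 : ℝ)), ((1 : ℝ), (0 : ℝ)),
    ((1 / 2 : ℝ), (Real.sqrt 3 / 2 : ℝ))} ⊆ Ktri := by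
  apply convexHull_min _ convex_Ktri
  have hs := s3pos
  rintro p (rfl | rfl | rfl) <;> simp only [Ktri, mem_ofPred_eq] <;>
    refine ⟨?_, ?_, ?_⟩ <;> linarith

lemma Etri_sub_hull : Etri ⊆ convexHull ℝ {((0 : ℝ), (0 : ℝ)), ((1 : ℝ), (0 : ℝ)),
    ((1 / 2 : ℝ), (Real.sqrt 3 / 2 : ℝ))} := by
  rintro ⟨x, y⟩ ⟨h1, h2, h3⟩
  simp only at h1 h2 h3
  have hs := s3pos
  have hsq := s3sq
  set V : Set (ℝ × ℝ) := {((0 : ℝ), (0 : ℝ)), ((1 : ℝ), (0 : ℝ)),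
    ((1 / 2 : ℝ), (Real.sqrt 3 / 2 : ℝ))} with hV
  have hc : Convex ℝ (convexHull ℝ V) := convex_convexHull ℝ V
  have m0 : ((0:ℝ),(0:ℝ)) ∈ convexHull ℝ V := subset_convexHull ℝ V (by simp [hV])
  have m1 : ((1:ℝ),(0:ℝ)) ∈ convexHull ℝ V := subset_convexHull ℝ V (by simp [hV])
  have m2 : ((1/2:ℝ),(Real.sqrt 3/2:ℝ)) ∈ convexHull ℝ V := subset_convexHull ℝ V (by simp [hV])
  have hne : Real.sqrt 3 ≠ 0 := hs.ne'
  have e1 : y / Real.sqrt 3 < x := by rw [div_lt_iff₀ hs]; linarith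
  have e2 : y / Real.sqrt 3 < 1 - x := by rw [div_lt_iff₀ hs]; linarith
  have e0 : 0 < y / Real.sqrt 3 := by positivity
  have := hc.sum_mem (t := (Finset.univ : Finset (Fin 3)))
    (w := ![1 - x - y / Real.sqrt 3, x - y / Real.sqrt 3, 2 * (y / Real.sqrt 3)])
    (z := ![((0:ℝ),(0:ℝ)), ((1:ℝ),(0:ℝ)), ((1/2:ℝ),(Real.sqrt 3/2:ℝ))])
    (by intro i _; fin_cases i <;> simp <;> linarith)
    (by simp [Fin.sum_univ_three]; ring)
    (by intro i _; fin_cases i <;> simp <;> first | exact m0 | exact m1 | simpa using m2)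
  convert this using 1
  simp [Fin.sum_univ_three]
  constructor
  · ring
  · field_simp

lemma tri_eq : equilateralTriangle = Etri := by
  apply Subset.antisymm
  · intro p hp
    have hp' : p ∈ interior Ktri := interior_mono hull_sub_Ktri hp
    have hs := s3pos
    have key : ∀ v : ℝ × ℝ, ∃ ε : ℝ, 0 < ε ∧ p + ε • v ∈ Ktri := by
      intro v
      have hc : Tendsto (fun ε : ℝ => p + ε • v) (𝓝[>] 0) (𝓝 (p + (0:ℝ) • v)) :=
        ((by fun_prop : Continuous (fun ε : ℝ => p + ε • v)).tendsto 0).mono_left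
          nhdsWithin_le_nhds
      rw [zero_smul, add_zero] at hc
      have h1 := hc.eventually (mem_interior_iff_mem_nhds.1 hp')
      obtain ⟨ε, h2, h3⟩ := (h1.and self_mem_nhdsWithin).exists
      exact ⟨ε, h3, h2⟩
    refine ⟨?_, ?_, ?_⟩
    · obtain ⟨ε, h0, h1, -, -⟩ := key (0, -1)
      simp at h1; linarith
    · obtain ⟨ε, h0, -, h1, -⟩ := key (-1, 0)
      simp at h1; nlinarith [mul_pos h0 hs]
    · obtain ⟨ε, h0, -, -, h1⟩ := key (1, 0)
      simp at h1; nlinarith [mul_pos h0 hs]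
  · exact interior_maximal Etri_sub_hull isOpen_Etri

/-- scaling towards the centroid -/
noncomputable def scl (r : ℝ) (p : ℝ × ℝ) : ℝ × ℝ :=
  (r * p.1 + (1 - r) * (1 / 2), r * p.2 + (1 - r) * (Real.sqrt 3 / 6))

lemma scl_mem {r : ℝ} (h0 : 0 ≤ r) (h1 : r < 1) {p : ℝ × ℝ} (hp : p ∈ Ktri) : scl r p ∈ Etri := by
  obtain ⟨a, b, c⟩ := hp
  have hs := s3pos
  have h2 : 0 < (1 - r) * Real.sqrt 3 := mul_pos (by linarith) hs
  simp only [scl, Etri, mem_ofPred_eq]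
  refine ⟨by nlinarith [mul_nonneg h0 a], ?_, ?_⟩
  · nlinarith [mul_le_mul_of_nonneg_left b h0]
  · nlinarith [mul_le_mul_of_nonneg_left c h0]

lemma continuous_scl : Continuous (fun q : ℝ × (ℝ × ℝ) => scl q.1 q.2) := by
  unfold scl; fun_prop

lemma scl_one (p : ℝ × ℝ) : scl 1 p = p := by simp [scl]

lemma tendsto_scl (p : ℝ × ℝ) : Tendsto (fun r => scl r p) (𝓝[<] 1) (𝓝 p) := by
  have : Continuous (fun r => scl r p) := by unfold scl; fun_prop
  have h := (this.tendsto 1).mono_left (nhdsWithin_le_nhds (s := Iio 1))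
  rwa [scl_one] at h

lemma ev_r : ∀ᶠ r : ℝ in 𝓝[<] 1, 0 ≤ r ∧ r < 1 := by
  have : ∀ᶠ r : ℝ in 𝓝[<] 1, 0 ≤ r :=
    (eventually_ge_nhds (by norm_num : (0:ℝ) < 1)).filter_mono nhdsWithin_le_nhds
  exact this.and self_mem_nhdsWithin

lemma Ktri_sub_closure : Ktri ⊆ closure Etri := by
  intro p hp
  refine mem_closure_of_tendsto (tendsto_scl p) ?_
  filter_upwards [ev_r] with r hr using scl_mem hr.1 hr.2 hp

lemma bdry_sub : Ktri \ Etri ⊆ frontier Etri := by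
  rw [isOpen_Etri.frontier_eq]
  exact fun p hp => ⟨Ktri_sub_closure hp.1, hp.2⟩

/-! ### exponentials -/
noncomputable def tau1 (p : ℝ × ℝ) : ℝ := 2 * p.1 / 3
noncomputable def tau2 (p : ℝ × ℝ) : ℝ := (Real.sqrt 3 * p.2 - p.1) / 3
noncomputable def tau3 (p : ℝ × ℝ) : ℝ := -(p.1 + Real.sqrt 3 * p.2) / 3

/-- `e^{2πit}` -/
noncomputable def ex (t : ℝ) : ℂ := Complex.exp (2 * Real.pi * t * Complex.I)

lemma ex_add (s t : ℝ) : ex (s + t) = ex s * ex t := by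
  simp only [ex, ← Complex.exp_add]; congr 1; push_cast; ring

lemma ex_zero : ex 0 = 1 := by simp [ex]

lemma ex_ne (t : ℝ) : ex t ≠ 0 := Complex.exp_ne_zero _

lemma ex_conj (t : ℝ) : (starRingEnd ℂ) (ex t) = ex (-t) := by
  simp only [ex, ← Complex.exp_conj]; congr 1; simp [Complex.conj_ofNat]

lemma ex_eq {s t : ℝ} (h : ex s = ex t) : ∃ n : ℤ, s = t + n := by
  obtain ⟨n, hn⟩ := Complex.exp_eq_exp_iff_exists_int.1 h
  refine ⟨n, ?_⟩
  have hpi : (2 * Real.pi * Complex.I : ℂ) ≠ 0 := Complex.two_pi_I_ne_zero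
  have : (s : ℂ) = t + n := by
    apply mul_left_cancel₀ hpi
    linear_combination hn
  exact_mod_cast this

lemma tau_K {p : ℝ × ℝ} (hp : p ∈ Ktri) :
    tau2 p ≤ tau1 p ∧ tau3 p ≤ tau2 p ∧ tau1 p ≤ tau3 p + 1 ∧ tau1 p + tau2 p + tau3 p = 0 := by
  obtain ⟨a, b, c⟩ := hp
  have hs := s3pos
  have hsq := s3sq
  unfold tau1 tau2 tau3
  refine ⟨?_, ?_, ?_, by ring⟩
  · nlinarith
  · nlinarith
  · nlinarith

lemma tau_E {p : ℝ × ℝ} (hp : p ∈ Etri) :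
    tau2 p < tau1 p ∧ tau3 p < tau2 p ∧ tau1 p < tau3 p + 1 := by
  obtain ⟨a, b, c⟩ := hp
  have hs := s3pos
  have hsq := s3sq
  unfold tau1 tau2 tau3
  refine ⟨?_, ?_, ?_⟩
  · nlinarith
  · nlinarith
  · nlinarith

lemma tau_bd {p : ℝ × ℝ} (hp : p ∈ Ktri) (h : p ∉ Etri) :
    tau1 p = tau2 p ∨ tau2 p = tau3 p ∨ tau1 p = tau3 p + 1 := by
  by_contra hh
  push Not at hh
  obtain ⟨h1, h2, h3⟩ := hh
  obtain ⟨k1, k2, k3, k4⟩ := tau_K hp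
  have h1 := lt_of_le_of_ne k1 h1.symm
  have h2 := lt_of_le_of_ne k2 h2.symm
  have h3 := lt_of_le_of_ne k3 h3
  have hs := s3pos
  have hsq := s3sq
  unfold tau1 tau2 tau3 at *
  refine h ⟨?_, ?_, ?_⟩
  · by_contra hc; push Not at hc; nlinarith
  · nlinarith
  · nlinarith

/-- purely real separation statement -/
lemma sep_real (a1 a2 a3 b1 b2 b3 : ℝ) (n1 n2 n3 : ℤ)
    (ha : a2 ≤ a1 ∧ a3 ≤ a2 ∧ a1 ≤ a3 + 1 ∧ a1 + a2 + a3 = 0)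
    (hb : b2 ≤ b1 ∧ b3 ≤ b2 ∧ b1 ≤ b3 + 1 ∧ b1 + b2 + b3 = 0)
    (c1 c2 c3 : ℝ)
    (hc : (c1 = b1 ∧ c2 = b2 ∧ c3 = b3) ∨ (c1 = b1 ∧ c2 = b3 ∧ c3 = b2) ∨
      (c1 = b2 ∧ c2 = b1 ∧ c3 = b3) ∨ (c1 = b2 ∧ c2 = b3 ∧ c3 = b1) ∨
      (c1 = b3 ∧ c2 = b1 ∧ c3 = b2) ∨ (c1 = b3 ∧ c2 = b2 ∧ c3 = b1))
    (h1 : a1 = c1 + n1) (h2 : a2 = c2 + n2) (h3 : a3 = c3 + n3) :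
    a1 = b1 ∧ a2 = b2 ∧ a3 = b3 := by
  obtain ⟨p1, p2, p3, p4⟩ := ha
  obtain ⟨q1, q2, q3, q4⟩ := hb
  have hn : n3 = - n1 - n2 := by
    have : (n3 : ℝ) = - n1 - n2 := by
      rcases hc with ⟨rfl, rfl, rfl⟩ | ⟨rfl, rfl, rfl⟩ | ⟨rfl, rfl, rfl⟩ | ⟨rfl, rfl, rfl⟩ |
        ⟨rfl, rfl, rfl⟩ | ⟨rfl, rfl, rfl⟩ <;> linarith
    exact_mod_cast this
  subst hn
  have B : ((n1 : ℝ) < 2 ∧ (-2 : ℝ) < n1) ∧ ((n2 : ℝ) < 2 ∧ (-2 : ℝ) < n2) := by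
    rcases hc with ⟨rfl, rfl, rfl⟩ | ⟨rfl, rfl, rfl⟩ | ⟨rfl, rfl, rfl⟩ | ⟨rfl, rfl, rfl⟩ |
        ⟨rfl, rfl, rfl⟩ | ⟨rfl, rfl, rfl⟩ <;> refine ⟨⟨?_, ?_⟩, ⟨?_, ?_⟩⟩ <;> linarith
  obtain ⟨⟨B1, B2⟩, B3, B4⟩ := B
  have B1 : n1 < 2 := by exact_mod_cast B1
  have B2 : -2 < n1 := by exact_mod_cast B2
  have B3 : n2 < 2 := by exact_mod_cast B3
  have B4 : -2 < n2 := by exact_mod_cast B4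
  push_cast at h3
  rcases hc with ⟨rfl, rfl, rfl⟩ | ⟨rfl, rfl, rfl⟩ | ⟨rfl, rfl, rfl⟩ | ⟨rfl, rfl, rfl⟩ |
        ⟨rfl, rfl, rfl⟩ | ⟨rfl, rfl, rfl⟩ <;> interval_cases n1 <;> interval_cases n2 <;>
    push_cast at * <;> refine ⟨?_, ?_, ?_⟩ <;> linarith

lemma perm_of_sym {x1 x2 x3 y1 y2 y3 : ℂ} (hx : x1 ≠ 0)
    (e1 : x1 + x2 + x3 = y1 + y2 + y3)
    (e2 : x1 * x2 + x1 * x3 + x2 * x3 = y1 * y2 + y1 * y3 + y2 * y3)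
    (e3 : x1 * x2 * x3 = y1 * y2 * y3) :
    (x1 = y1 ∧ x2 = y2 ∧ x3 = y3) ∨ (x1 = y1 ∧ x2 = y3 ∧ x3 = y2) ∨
      (x1 = y2 ∧ x2 = y1 ∧ x3 = y3) ∨ (x1 = y2 ∧ x2 = y3 ∧ x3 = y1) ∨
      (x1 = y3 ∧ x2 = y1 ∧ x3 = y2) ∨ (x1 = y3 ∧ x2 = y2 ∧ x3 = y1) := by
  have aux : ∀ a b c d : ℂ, a + b = c + d → a * b = c * d → (a = c ∧ b = d) ∨ (a = d ∧ b = c) := by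
    intro a b c d h1 h2
    have : (a - c) * (a - d) = 0 := by linear_combination a * h1 - h2
    rcases mul_eq_zero.1 this with h | h
    · left; have : a = c := by linear_combination h
      exact ⟨this, by linear_combination h1 - this⟩
    · right; have : a = d := by linear_combination h
      exact ⟨this, by linear_combination h1 - this⟩
  have h : (x1 - y1) * ((x1 - y2) * (x1 - y3)) = 0 := by
    linear_combination x1 ^ 2 * e1 - x1 * e2 + e3
  rcases mul_eq_zero.1 h with h | h
  · have h : x1 = y1 := by linear_combination h
    subst h
    rcases aux x2 x3 y2 y3 (by linear_combination e1)
      (mul_left_cancel₀ hx (by linear_combination e3)) with h | h <;> simp [h]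
  rcases mul_eq_zero.1 h with h | h
  · have h : x1 = y2 := by linear_combination h
    subst h
    rcases aux x2 x3 y1 y3 (by linear_combination e1)
      (mul_left_cancel₀ hx (by linear_combination e3)) with h | h <;> simp [h]
  · have h : x1 = y3 := by linear_combination h
    subst h
    rcases aux x2 x3 y1 y2 (by linear_combination e1)
      (mul_left_cancel₀ hx (by linear_combination e3)) with h | h <;> simp [h]

/-- the fundamental character -/
noncomputable def zf (p : ℝ × ℝ) : ℂ := ex (tau1 p) + ex (tau2 p) + ex (tau3 p)

lemma ex_prod (p : ℝ × ℝ) : ex (tau1 p) * ex (tau2 p) * ex (tau3 p) = 1 := by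
  rw [← ex_add, ← ex_add, ← ex_zero]; congr 1; unfold tau1 tau2 tau3; ring

lemma e2_eq (p : ℝ × ℝ) : ex (tau1 p) * ex (tau2 p) + ex (tau1 p) * ex (tau3 p) +
    ex (tau2 p) * ex (tau3 p) = (starRingEnd ℂ) (zf p) := by
  simp only [zf, map_add, ex_conj, ← ex_add]
  have h1 : tau1 p + tau2 p = - tau3 p := by unfold tau1 tau2 tau3; ring
  have h2 : tau1 p + tau3 p = - tau2 p := by unfold tau1 tau2 tau3; ring
  have h3 : tau2 p + tau3 p = - tau1 p := by unfold tau1 tau2 tau3; ring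
  rw [h1, h2, h3]; ring

lemma zf_inj {p q : ℝ × ℝ} (hp : p ∈ Ktri) (hq : q ∈ Ktri) (h : zf p = zf q) : p = q := by
  have hperm := perm_of_sym (ex_ne (tau1 p)) (x2 := ex (tau2 p)) (x3 := ex (tau3 p))
    (y1 := ex (tau1 q)) (y2 := ex (tau2 q)) (y3 := ex (tau3 q)) h
    (by rw [e2_eq, e2_eq, h]) (by rw [ex_prod, ex_prod])
  have key : tau1 p = tau1 q ∧ tau2 p = tau2 q ∧ tau3 p = tau3 q := by
    rcases hperm with ⟨h1, h2, h3⟩ | ⟨h1, h2, h3⟩ | ⟨h1, h2, h3⟩ | ⟨h1, h2, h3⟩ |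
        ⟨h1, h2, h3⟩ | ⟨h1, h2, h3⟩ <;>
      obtain ⟨n1, h1⟩ := ex_eq h1 <;> obtain ⟨n2, h2⟩ := ex_eq h2 <;>
      obtain ⟨n3, h3⟩ := ex_eq h3 <;>
      exact sep_real _ _ _ _ _ _ n1 n2 n3 (tau_K hp) (tau_K hq) _ _ _ (by simp) h1 h2 h3
  obtain ⟨k1, k2, -⟩ := key
  unfold tau1 at k1
  unfold tau2 at k2
  have : p.1 = q.1 := by linarith
  refine Prod.ext this ?_
  apply mul_left_cancel₀ s3pos.ne'
  linarith

/-- monomials -/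
noncomputable def mon (a b c : ℤ) (p : ℝ × ℝ) : ℂ := ex (a * tau1 p + b * tau2 p + c * tau3 p)

/-- Lamé functions -/
noncomputable def lame (a b c : ℤ) (p : ℝ × ℝ) : ℂ :=
  mon a b c p + mon b c a p + mon c a b p - mon a c b p - mon b a c p - mon c b a p

lemma ex_add_int (t : ℝ) (n : ℤ) : ex (t + n) = ex t := by
  rw [ex_add]
  have : ex n = 1 := by
    unfold ex
    rw [Complex.exp_eq_one_iff]
    exact ⟨n, by push_cast; ring⟩
  rw [this, mul_one]

lemma mon_eq_add (a b c : ℤ) (p : ℝ × ℝ) :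
    mon a b c p = ex (a * tau1 p) * ex (b * tau2 p) * ex (c * tau3 p) := by
  unfold mon; rw [ex_add, ex_add]

lemma lame_bdry (a b c : ℤ) {p : ℝ × ℝ} (hp : p ∈ Ktri) (h : p ∉ Etri) : lame a b c p = 0 := by
  rcases tau_bd hp h with h | h | h
  · simp only [lame, mon_eq_add, h]; ring
  · simp only [lame, mon_eq_add, h]; ring
  · have : ∀ n : ℤ, ex (n * tau1 p) = ex (n * tau3 p) := by
      intro n
      rw [h, mul_add, mul_one, ex_add_int]
    simp only [lame, mon_eq_add, this]; ring

lemma lame_degen {a b c : ℤ} (h : a = b ∨ b = c ∨ a = c) (p : ℝ × ℝ) : lame a b c p = 0 := by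
  rcases h with rfl | rfl | rfl <;> unfold lame <;> ring

lemma zf_mul_lame (a b c : ℤ) (p : ℝ × ℝ) :
    zf p * lame a b c p = lame (a+1) b c p + lame a (b+1) c p + lame a b (c+1) p := by
  have h1 : ∀ (n : ℤ) (t : ℝ), ex ((n + 1 : ℤ) * t) = ex (n * t) * ex t := by
    intro n t; rw [← ex_add]; congr 1; push_cast; ring
  simp only [lame, mon_eq_add, h1, zf]; ring

lemma zfc_mul_lame (a b c : ℤ) (p : ℝ × ℝ) :
    (starRingEnd ℂ) (zf p) * lame a b c p =
      lame (a-1) b c p + lame a (b-1) c p + lame a b (c-1) p := by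
  have h1 : ∀ (n : ℤ) (t : ℝ), ex ((n - 1 : ℤ) * t) = ex (n * t) * ex (-t) := by
    intro n t; rw [← ex_add]; congr 1; push_cast; ring
  simp only [lame, mon_eq_add, h1, zf, map_add, ex_conj]; ring

lemma lame_rho_ne {p : ℝ × ℝ} (hp : p ∈ Etri) : lame 0 1 2 p ≠ 0 := by
  have h2 : ∀ t : ℝ, ex ((2 : ℤ) * t) = ex t * ex t := by
    intro t; rw [← ex_add]; congr 1; push_cast; ring
  have h1 : ∀ t : ℝ, ex ((1 : ℤ) * t) = ex t := by intro t; simp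
  have h0 : ∀ t : ℝ, ex ((0 : ℤ) * t) = 1 := by intro t; simp [ex_zero]
  have : lame 0 1 2 p = (ex (tau2 p) - ex (tau1 p)) * (ex (tau3 p) - ex (tau1 p)) *
      (ex (tau3 p) - ex (tau2 p)) := by
    simp only [lame, mon_eq_add, h0, h1, h2]; ring
  rw [this]
  obtain ⟨k1, k2, k3⟩ := tau_E hp
  have aux : ∀ s t : ℝ, s < t → t < s + 1 → ex s - ex t ≠ 0 := by
    intro s t hst hts h
    obtain ⟨n, hn⟩ := ex_eq (sub_eq_zero.1 h)
    have a1 : (n : ℝ) < 0 := by linarith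
    have a2 : (-1 : ℝ) < n := by linarith
    have a1 : n < 0 := by exact_mod_cast a1
    have a2 : -1 < n := by exact_mod_cast a2
    omega
  exact mul_ne_zero (mul_ne_zero (aux _ _ k1 (by linarith)) (aux _ _ (by linarith) k3))
    (aux _ _ k2 (by linarith))

/-! ### Green's identity -/

lemma chord_bound {f f' f'' : ℝ → ℝ} {g g' g'' : ℝ → ℂ} {a b ε M : ℝ} (hab : a ≤ b)
    (hf : ∀ x ∈ Icc a b, HasDerivAt f (f' x) x) (hf' : ∀ x ∈ Icc a b, HasDerivAt f' (f'' x) x)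
    (hg : ∀ x ∈ Icc a b, HasDerivAt g (g' x) x) (hg' : ∀ x ∈ Icc a b, HasDerivAt g' (g'' x) x)
    (cf : ContinuousOn f'' (Icc a b)) (cg : ContinuousOn g'' (Icc a b))
    (ga : g a = 0) (gb : g b = 0) (fa : |f a| ≤ ε) (fb : |f b| ≤ ε)
    (Ma : ‖g' a‖ ≤ M) (Mb : ‖g' b‖ ≤ M) :
    ‖∫ x in a..b, (f x • g'' x - f'' x • g x)‖ ≤ 2 * ε * M := by
  have hε : 0 ≤ ε := (abs_nonneg _).trans fa
  have hd : ∀ x ∈ uIcc a b, HasDerivAt (fun x => f x • g' x - f' x • g x)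
      (f x • g'' x - f'' x • g x) x := by
    intro x hx
    rw [uIcc_of_le hab] at hx
    have := ((hf x hx).smul (hg' x hx)).sub ((hf' x hx).smul (hg x hx))
    refine this.congr_deriv ?_
    module
  have hi : IntervalIntegrable (fun x => f x • g'' x - f'' x • g x) volume a b := by
    apply ContinuousOn.intervalIntegrable
    rw [uIcc_of_le hab]
    have c1 : ContinuousOn f (Icc a b) := fun x hx => (hf x hx).continuousAt.continuousWithinAt
    have c2 : ContinuousOn g (Icc a b) := fun x hx => (hg x hx).continuousAt.continuousWithinAt
    exact (c1.smul cg).sub (cf.smul c2)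
  rw [intervalIntegral.integral_eq_sub_of_hasDerivAt hd hi]
  simp only [ga, gb, smul_zero, sub_zero]
  refine (norm_sub_le _ _).trans ?_
  rw [norm_smul, norm_smul, Real.norm_eq_abs, Real.norm_eq_abs]
  have h1 := mul_le_mul fb Mb (norm_nonneg _) hε
  have h2 := mul_le_mul fa Ma (norm_nonneg _) hε
  linarith

lemma slice_eq {G : ℝ → ℂ} {S : Set ℝ} {a b : ℝ} (hab : a ≤ b) (hS : S = Icc a b) :
    ∫ y, S.indicator G y = ∫ y in a..b, G y := by
  subst hS
  rw [integral_indicator measurableSet_Icc, intervalIntegral.integral_of_le hab,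
    integral_Icc_eq_integral_Ioc]

lemma outer_bound {H : ℝ → ℂ} {b C : ℝ} (hb : 0 ≤ b) (hb1 : b ≤ 1) (hC : 0 ≤ C)
    (h1 : ∀ x ∈ Icc 0 b, ‖H x‖ ≤ C)
    (h2 : ∀ x ∉ Icc 0 b, H x = 0) : ‖∫ x, H x‖ ≤ C := by
  have : ∫ x, H x = ∫ x in Icc 0 b, H x := by
    rw [setIntegral_eq_integral_of_forall_compl_eq_zero]
    exact h2
  rw [this]
  refine (norm_setIntegral_le_of_norm_le_const (by simp) h1).trans ?_
  simp [measureReal_def, hb]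
  nlinarith

lemma int_K_y {G : ℝ × ℝ → ℂ} (hG : ContinuousOn G Ktri) {C : ℝ} (hC : 0 ≤ C)
    (h : ∀ x ∈ Icc (0:ℝ) 1,
      ‖∫ y in (0:ℝ)..(min (Real.sqrt 3 * x) (Real.sqrt 3 * (1 - x))), G (x, y)‖ ≤ C) :
    ‖∫ p in Ktri, G p‖ ≤ C := by
  have hs := s3pos
  have hm := isClosed_Ktri.measurableSet
  have hi : Integrable (Ktri.indicator G) :=
    (hG.integrableOn_compact isCompact_Ktri).integrable_indicator hm
  rw [← integral_indicator hm, Measure.volume_eq_prod, integral_prod _ hi]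
  refine outer_bound zero_le_one le_rfl hC (fun x hx => ?_) (fun x hx => ?_)
  · have : ∀ y, Ktri.indicator G (x, y) = (Icc (0:ℝ) (min (Real.sqrt 3 * x)
        (Real.sqrt 3 * (1 - x)))).indicator (fun y => G (x, y)) y := by
      intro y
      by_cases hy : (x, y) ∈ Ktri
      · rw [indicator_of_mem hy, indicator_of_mem]
        exact ⟨hy.1, le_min hy.2.1 hy.2.2⟩
      · rw [indicator_of_notMem hy, indicator_of_notMem]
        exact fun h => hy ⟨h.1, h.2.trans (min_le_left _ _), h.2.trans (min_le_right _ _)⟩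
    simp_rw [this]
    rw [slice_eq (le_min (mul_nonneg hs.le hx.1) (mul_nonneg hs.le (by linarith [hx.2]))) rfl]
    exact h x hx
  · rw [← integral_zero (α := ℝ) (μ := volume) ℂ]
    congr 1
    ext1 y
    apply indicator_of_notMem
    intro hp
    obtain ⟨a, b, -, -⟩ := Ktri_bounds hp
    exact hx ⟨a, b⟩

lemma int_K_x {G : ℝ × ℝ → ℂ} (hG : ContinuousOn G Ktri) {C : ℝ} (hC : 0 ≤ C)
    (h : ∀ y ∈ Icc (0:ℝ) (Real.sqrt 3 / 2),
      ‖∫ x in (y / Real.sqrt 3)..(1 - y / Real.sqrt 3), G (x, y)‖ ≤ C) :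
    ‖∫ p in Ktri, G p‖ ≤ C := by
  have hs := s3pos
  have hsq := s3sq
  have hm := isClosed_Ktri.measurableSet
  have hi : Integrable (Ktri.indicator G) :=
    (hG.integrableOn_compact isCompact_Ktri).integrable_indicator hm
  rw [← integral_indicator hm, Measure.volume_eq_prod, integral_prod_symm _ hi]
  refine outer_bound (b := Real.sqrt 3 / 2) (by positivity) (by nlinarith) hC
    (fun y hy => ?_) (fun y hy => ?_)
  · have : ∀ x, Ktri.indicator G (x, y) = (Icc (y / Real.sqrt 3)
        (1 - y / Real.sqrt 3)).indicator (fun x => G (x, y)) x := by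
      intro x
      have e : (x, y) ∈ Ktri ↔ x ∈ Icc (y / Real.sqrt 3) (1 - y / Real.sqrt 3) := by
        have e1 : y / Real.sqrt 3 ≤ x ↔ y ≤ Real.sqrt 3 * x := by
          rw [div_le_iff₀ hs, mul_comm]
        have e2 : x ≤ 1 - y / Real.sqrt 3 ↔ y ≤ Real.sqrt 3 * (1 - x) := by
          rw [le_sub_comm, div_le_iff₀ hs, mul_comm]
        rw [mem_Icc, e1, e2]
        exact ⟨fun h => h.2, fun h => ⟨hy.1, h⟩⟩
      by_cases hx : (x, y) ∈ Ktri
      · rw [indicator_of_mem hx, indicator_of_mem (e.1 hx)]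
      · rw [indicator_of_notMem hx, indicator_of_notMem (fun h => hx (e.2 h))]
    simp_rw [this]
    have : y / Real.sqrt 3 ≤ 1 / 2 := by
      rw [div_le_iff₀ hs]; linarith [hy.2]
    rw [slice_eq (by linarith) rfl]
    exact h y hy
  · rw [← integral_zero (α := ℝ) (μ := volume) ℂ]
    congr 1
    ext1 x
    apply indicator_of_notMem
    intro hp
    obtain ⟨a, b, c⟩ := hp
    simp only at a b c
    exact hy ⟨a, by linarith⟩

lemma green_bound {U Ux Uxx Uy Uyy : ℝ × ℝ → ℝ} {W Wx Wxx Wy Wyy : ℝ × ℝ → ℂ} {ε M : ℝ}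
    (hε : 0 ≤ ε) (hM : 0 ≤ M)
    (u1 : ∀ p ∈ Ktri, HasDerivAt (fun x => U (x, p.2)) (Ux p) p.1)
    (u2 : ∀ p ∈ Ktri, HasDerivAt (fun x => Ux (x, p.2)) (Uxx p) p.1)
    (u3 : ∀ p ∈ Ktri, HasDerivAt (fun y => U (p.1, y)) (Uy p) p.2)
    (u4 : ∀ p ∈ Ktri, HasDerivAt (fun y => Uy (p.1, y)) (Uyy p) p.2)
    (w1 : ∀ p ∈ Ktri, HasDerivAt (fun x => W (x, p.2)) (Wx p) p.1)
    (w2 : ∀ p ∈ Ktri, HasDerivAt (fun x => Wx (x, p.2)) (Wxx p) p.1)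
    (w3 : ∀ p ∈ Ktri, HasDerivAt (fun y => W (p.1, y)) (Wy p) p.2)
    (w4 : ∀ p ∈ Ktri, HasDerivAt (fun y => Wy (p.1, y)) (Wyy p) p.2)
    (cU : ContinuousOn U Ktri) (cUxx : ContinuousOn Uxx Ktri) (cUyy : ContinuousOn Uyy Ktri)
    (cW : ContinuousOn W Ktri) (cWxx : ContinuousOn Wxx Ktri) (cWyy : ContinuousOn Wyy Ktri)
    (bW : ∀ p ∈ Ktri, p ∉ Etri → W p = 0) (bU : ∀ p ∈ Ktri, p ∉ Etri → |U p| ≤ ε)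
    (bWx : ∀ p ∈ Ktri, ‖Wx p‖ ≤ M) (bWy : ∀ p ∈ Ktri, ‖Wy p‖ ≤ M) :
    ‖∫ p in Ktri, (U p • (Wxx p + Wyy p) - (Uxx p + Uyy p) • W p)‖ ≤ 4 * ε * M := by
  have hs := s3pos
  have hsq := s3sq
  have hC : 0 ≤ 2 * ε * M := by positivity
  have cx : ContinuousOn (fun p => U p • Wxx p - Uxx p • W p) Ktri :=
    (cU.smul cWxx).sub (cUxx.smul cW)
  have cy : ContinuousOn (fun p => U p • Wyy p - Uyy p • W p) Ktri :=
    (cU.smul cWyy).sub (cUyy.smul cW)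
  have hx := int_K_x cx hC (by
    intro y hy
    have hy2 : y / Real.sqrt 3 ≤ 1 / 2 := by
      rw [div_le_iff₀ hs]; linarith [hy.2]
    have hys : Real.sqrt 3 * (y / Real.sqrt 3) = y := by field_simp
    have hK : ∀ x ∈ Icc (y / Real.sqrt 3) (1 - y / Real.sqrt 3), (x, y) ∈ Ktri := by
      intro x hx
      refine ⟨hy.1, ?_, ?_⟩ <;> simp only
      · nlinarith [mul_le_mul_of_nonneg_left hx.1 hs.le]
      · nlinarith [mul_le_mul_of_nonneg_left hx.2 hs.le]
    have hle : y / Real.sqrt 3 ≤ 1 - y / Real.sqrt 3 := by linarith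
    have ka := hK _ (left_mem_Icc.2 hle)
    have kb := hK _ (right_mem_Icc.2 hle)
    have na : (y / Real.sqrt 3, y) ∉ Etri := by
      intro h; have := h.2.1; simp only [hys] at this; exact lt_irrefl _ this
    have nb : (1 - y / Real.sqrt 3, y) ∉ Etri := by
      intro h; have := h.2.2; simp only [sub_sub_cancel, hys] at this; exact lt_irrefl _ this
    have mp : MapsTo (fun x : ℝ => (x, y)) (Icc (y / Real.sqrt 3) (1 - y / Real.sqrt 3)) Ktri := hK
    have cc : ContinuousOn (fun x : ℝ => (x, y)) (Icc (y / Real.sqrt 3) (1 - y / Real.sqrt 3)) := by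
      fun_prop
    exact chord_bound (f := fun x => U (x, y)) (f' := fun x => Ux (x, y))
      (f'' := fun x => Uxx (x, y)) (g := fun x => W (x, y)) (g' := fun x => Wx (x, y))
      (g'' := fun x => Wxx (x, y)) hle
      (fun x hx => u1 _ (hK x hx)) (fun x hx => u2 _ (hK x hx))
      (fun x hx => w1 _ (hK x hx)) (fun x hx => w2 _ (hK x hx))
      (cUxx.comp cc mp) (cWxx.comp cc mp) (bW _ ka na) (bW _ kb nb) (bU _ ka na) (bU _ kb nb)
      (bWx _ ka) (bWx _ kb))
  have hy := int_K_y cy hC (by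
    intro x hx
    set T := min (Real.sqrt 3 * x) (Real.sqrt 3 * (1 - x)) with hT
    have hle : 0 ≤ T := le_min (mul_nonneg hs.le hx.1) (mul_nonneg hs.le (by linarith [hx.2]))
    have hK : ∀ y ∈ Icc 0 T, (x, y) ∈ Ktri := by
      intro y hy
      exact ⟨hy.1, hy.2.trans (min_le_left _ _), hy.2.trans (min_le_right _ _)⟩
    have ka := hK _ (left_mem_Icc.2 hle)
    have kb := hK _ (right_mem_Icc.2 hle)
    have na : (x, (0:ℝ)) ∉ Etri := fun h => lt_irrefl _ h.1
    have nb : (x, T) ∉ Etri := fun h => lt_irrefl T (lt_min h.2.1 h.2.2)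
    have mp : MapsTo (fun y : ℝ => (x, y)) (Icc 0 T) Ktri := hK
    have cc : ContinuousOn (fun y : ℝ => (x, y)) (Icc 0 T) := by
      fun_prop
    exact chord_bound (f := fun y => U (x, y)) (f' := fun y => Uy (x, y))
      (f'' := fun y => Uyy (x, y)) (g := fun y => W (x, y)) (g' := fun y => Wy (x, y))
      (g'' := fun y => Wyy (x, y)) hle
      (fun y hy => u3 _ (hK y hy)) (fun y hy => u4 _ (hK y hy))
      (fun y hy => w3 _ (hK y hy)) (fun y hy => w4 _ (hK y hy))
      (cUyy.comp cc mp) (cWyy.comp cc mp) (bW _ ka na) (bW _ kb nb) (bU _ ka na) (bU _ kb nb)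
      (bWy _ ka) (bWy _ kb))
  have : ∫ p in Ktri, (U p • (Wxx p + Wyy p) - (Uxx p + Uyy p) • W p) =
      (∫ p in Ktri, (U p • Wxx p - Uxx p • W p)) + ∫ p in Ktri, (U p • Wyy p - Uyy p • W p) := by
    rw [← integral_add (cx.integrableOn_compact isCompact_Ktri)
      (cy.integrableOn_compact isCompact_Ktri)]
    congr 1
    ext1 p
    rw [smul_add, add_smul]; abel
  rw [this]
  refine (norm_add_le _ _).trans ?_
  linarith

/-! ### derivatives of the Lamé functions -/

noncomputable def kA (a b c : ℤ) : ℂ := 2 * Real.pi * Complex.I * (((2 * a - b - c : ℝ) / 3 : ℝ) : ℂ)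
noncomputable def kB (a b c : ℤ) : ℂ :=
  2 * Real.pi * Complex.I * ((Real.sqrt 3 * (b - c : ℝ) / 3 : ℝ) : ℂ)

lemma hasDerivAt_ex (A t x : ℝ) : HasDerivAt (fun x : ℝ => ex (A * x + t))
    (2 * Real.pi * Complex.I * A * ex (A * x + t)) x := by
  unfold ex
  have h1 : HasDerivAt (fun x : ℝ => ((A * x + t : ℝ) : ℂ)) ((A : ℝ) : ℂ) x := by
    apply HasDerivAt.ofReal_comp
    simpa using ((hasDerivAt_id x).const_mul A).add_const t
  have h2 := (((h1.const_mul (2 * Real.pi : ℂ)).mul_const Complex.I)).cexp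
  convert h2 using 1
  ring

lemma mon_dx (a b c : ℤ) (p : ℝ × ℝ) :
    HasDerivAt (fun x => mon a b c (x, p.2)) (kA a b c * mon a b c p) p.1 := by
  have h := hasDerivAt_ex ((2 * a - b - c : ℝ) / 3) (Real.sqrt 3 * (b - c : ℝ) / 3 * p.2) p.1
  have e : ∀ x, mon a b c (x, p.2) =
      ex ((2 * a - b - c : ℝ) / 3 * x + Real.sqrt 3 * (b - c : ℝ) / 3 * p.2) := by
    intro x; unfold mon tau1 tau2 tau3; congr 1; ring
  have e' : mon a b c p =
      ex ((2 * a - b - c : ℝ) / 3 * p.1 + Real.sqrt 3 * (b - c : ℝ) / 3 * p.2) := e p.1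
  rw [e', funext e]
  exact h

lemma mon_dy (a b c : ℤ) (p : ℝ × ℝ) :
    HasDerivAt (fun y => mon a b c (p.1, y)) (kB a b c * mon a b c p) p.2 := by
  have h := hasDerivAt_ex (Real.sqrt 3 * (b - c : ℝ) / 3) ((2 * a - b - c : ℝ) / 3 * p.1) p.2
  have e : ∀ y, mon a b c (p.1, y) =
      ex (Real.sqrt 3 * (b - c : ℝ) / 3 * y + (2 * a - b - c : ℝ) / 3 * p.1) := by
    intro x; unfold mon tau1 tau2 tau3; congr 1; ring
  have e' : mon a b c p =
      ex (Real.sqrt 3 * (b - c : ℝ) / 3 * p.2 + (2 * a - b - c : ℝ) / 3 * p.1) := e p.2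
  rw [e', funext e]
  exact h

lemma continuous_ex : Continuous ex := by unfold ex; fun_prop

lemma continuous_mon (a b c : ℤ) : Continuous (mon a b c) := by
  unfold mon tau1 tau2 tau3
  exact continuous_ex.comp (by fun_prop)

lemma continuous_zf : Continuous zf := by
  unfold zf tau1 tau2 tau3
  exact ((continuous_ex.comp (by fun_prop)).add (continuous_ex.comp (by fun_prop))).add
    (continuous_ex.comp (by fun_prop))

/-- weighted Lamé functions -/
noncomputable def wl (k : ℤ → ℤ → ℤ → ℂ) (a b c : ℤ) (p : ℝ × ℝ) : ℂ :=
  k a b c * mon a b c p + k b c a * mon b c a p + k c a b * mon c a b p - k a c b * mon a c b p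
    - k b a c * mon b a c p - k c b a * mon c b a p

lemma continuous_wl (k) (a b c : ℤ) : Continuous (wl k a b c) := by
  unfold wl
  have := continuous_mon
  fun_prop

lemma wl_dx (k) (a b c : ℤ) (p : ℝ × ℝ) :
    HasDerivAt (fun x => wl k a b c (x, p.2)) (wl (fun a b c => k a b c * kA a b c) a b c p) p.1 := by
  have h := fun a b c => (mon_dx a b c p).const_mul (k a b c)
  refine HasDerivAt.congr_deriv ((((((h a b c).add (h b c a)).add (h c a b)).sub
    (h a c b)).sub (h b a c)).sub (h c b a)) ?_
  simp only [wl, mul_assoc]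

lemma wl_dy (k) (a b c : ℤ) (p : ℝ × ℝ) :
    HasDerivAt (fun y => wl k a b c (p.1, y)) (wl (fun a b c => k a b c * kB a b c) a b c p) p.2 := by
  have h := fun a b c => (mon_dy a b c p).const_mul (k a b c)
  refine HasDerivAt.congr_deriv ((((((h a b c).add (h b c a)).add (h c a b)).sub
    (h a c b)).sub (h b a c)).sub (h c b a)) ?_
  simp only [wl, mul_assoc]

lemma lame_eq_wl (a b c : ℤ) : lame a b c = wl (fun _ _ _ => 1) a b c := by
  ext p; simp [lame, wl]

/-- the eigenvalue -/
noncomputable def muq (a b c : ℤ) : ℝ :=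
  (4 * Real.pi / 3) ^ 2 * ((a:ℝ)^2 + (b:ℝ)^2 + (c:ℝ)^2 - a * b - b * c - a * c)

lemma kk (a b c : ℤ) : kA a b c * kA a b c + kB a b c * kB a b c = - (muq a b c : ℂ) := by
  unfold kA kB muq
  have h3 : ((Real.sqrt 3 : ℝ) : ℂ) ^ 2 = 3 := by
    rw [← Complex.ofReal_pow, Real.sq_sqrt (by norm_num)]; norm_num
  push_cast
  linear_combination (4 * (Real.pi:ℂ)^2 * ((2 * a - b - c : ℂ) / 3)^2
    + 4 * (Real.pi:ℂ)^2 * Real.sqrt 3 ^ 2 * ((b - c : ℂ) / 3)^2) * Complex.I_sq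
    - (4 * (Real.pi:ℂ)^2 * ((b - c : ℂ) / 3)^2) * h3

lemma lap_lame (a b c : ℤ) (p : ℝ × ℝ) :
    wl (fun a b c => 1 * kA a b c * kA a b c) a b c p +
      wl (fun a b c => 1 * kB a b c * kB a b c) a b c p = - (muq a b c : ℂ) * lame a b c p := by
  have m1 : muq b c a = muq a b c := by unfold muq; ring
  have m2 : muq c a b = muq a b c := by unfold muq; ring
  have m3 : muq a c b = muq a b c := by unfold muq; ring
  have m4 : muq b a c = muq a b c := by unfold muq; ring
  have m5 : muq c b a = muq a b c := by unfold muq; ring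
  have k0 := kk a b c
  have k1 := kk b c a
  have k2 := kk c a b
  have k3 := kk a c b
  have k4 := kk b a c
  have k5 := kk c b a
  rw [m1] at k1
  rw [m2] at k2
  rw [m3] at k3
  rw [m4] at k4
  rw [m5] at k5
  unfold wl lame
  linear_combination k0 * mon a b c p + k1 * mon b c a p + k2 * mon c a b p - k3 * mon a c b p
    - k4 * mon b a c p - k5 * mon c b a p

lemma exists_form {a b c : ℤ} (h : ¬ (a = b ∨ b = c ∨ a = c)) :
    ∃ j k : ℕ, 0 < j ∧ 0 < k ∧
      muq a b c = (4 * Real.pi / 3) ^ 2 * ((j : ℝ) ^ 2 + (k : ℝ) ^ 2 + j * k) := by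
  push Not at h
  obtain ⟨h1, h2, h3⟩ := h
  have key : ∀ a b c : ℤ, a < b → b < c → ∃ j k : ℕ, 0 < j ∧ 0 < k ∧
      muq a b c = (4 * Real.pi / 3) ^ 2 * ((j : ℝ) ^ 2 + (k : ℝ) ^ 2 + j * k) := by
    intro a b c hab hbc
    obtain ⟨j, hj⟩ := Int.eq_ofNat_of_zero_le (sub_nonneg.2 hab.le)
    obtain ⟨k, hk⟩ := Int.eq_ofNat_of_zero_le (sub_nonneg.2 hbc.le)
    refine ⟨j, k, by omega, by omega, ?_⟩
    have hj' : (j : ℝ) = b - a := by exact_mod_cast hj.symm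
    have hk' : (k : ℝ) = c - b := by exact_mod_cast hk.symm
    rw [hj', hk', muq]; ring
  have m1 : muq a b c = muq b c a := by unfold muq; ring
  have m2 : muq a b c = muq c a b := by unfold muq; ring
  have m3 : muq a b c = muq a c b := by unfold muq; ring
  have m4 : muq a b c = muq b a c := by unfold muq; ring
  have m5 : muq a b c = muq c b a := by unfold muq; ring
  rcases lt_or_gt_of_ne h1 with h1 | h1 <;> rcases lt_or_gt_of_ne h2 with h2 | h2 <;>
    rcases lt_or_gt_of_ne h3 with h3 | h3
  · exact key _ _ _ h1 h2
  · exact key _ _ _ h1 h2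
  · rw [m3]; exact key _ _ _ h3 h2
  · rw [m2]; exact key _ _ _ h3 h1
  · rw [m4]; exact key _ _ _ h1 h3
  · rw [m1]; exact key _ _ _ h2 h3
  · omega
  · rw [m5]; exact key _ _ _ h2 h1

/-! ### derivatives of `u ∘ scl r` -/

noncomputable def dX (v : ℝ × ℝ → ℝ) (q : ℝ × ℝ) : ℝ := fderiv ℝ v q (1, 0)
noncomputable def dY (v : ℝ × ℝ → ℝ) (q : ℝ × ℝ) : ℝ := fderiv ℝ v q (0, 1)

lemma scl_dx {v : ℝ × ℝ → ℝ} {r : ℝ} {p : ℝ × ℝ} (hv : DifferentiableAt ℝ v (scl r p)) :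
    HasDerivAt (fun x => v (scl r (x, p.2))) (r * dX v (scl r p)) p.1 := by
  have h1 : HasDerivAt (fun x => scl r (x, p.2)) (r, 0) p.1 := by
    simp only [scl]
    refine HasDerivAt.prodMk ?_ (hasDerivAt_const _ _)
    simpa using ((hasDerivAt_id p.1).const_mul r).add_const ((1 - r) * (1 / 2))
  have h2 := HasFDerivAt.comp_hasDerivAt (x := p.1) (f := fun x => scl r (x, p.2))
    (l := v) (l' := fderiv ℝ v (scl r p)) hv.hasFDerivAt h1
  refine h2.congr_deriv ?_
  have : ((r, 0) : ℝ × ℝ) = r • ((1:ℝ), (0:ℝ)) := by simp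
  rw [this, map_smul]; rfl

lemma scl_dy {v : ℝ × ℝ → ℝ} {r : ℝ} {p : ℝ × ℝ} (hv : DifferentiableAt ℝ v (scl r p)) :
    HasDerivAt (fun y => v (scl r (p.1, y))) (r * dY v (scl r p)) p.2 := by
  have h1 : HasDerivAt (fun y => scl r (p.1, y)) (0, r) p.2 := by
    simp only [scl]
    refine HasDerivAt.prodMk (hasDerivAt_const _ _) ?_
    simpa using ((hasDerivAt_id p.2).const_mul r).add_const ((1 - r) * (Real.sqrt 3 / 6))
  have h2 := HasFDerivAt.comp_hasDerivAt (x := p.2) (f := fun y => scl r (p.1, y))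
    (l := v) (l' := fderiv ℝ v (scl r p)) hv.hasFDerivAt h1
  refine h2.congr_deriv ?_
  have : ((0, r) : ℝ × ℝ) = r • ((0:ℝ), (1:ℝ)) := by simp
  rw [this, map_smul]; rfl

lemma smooth_dX {u : ℝ × ℝ → ℝ} {m n : WithTop ℕ∞} (hmn : m + 1 ≤ n) (hu : ContDiffOn ℝ n u Etri) :
    ContDiffOn ℝ m (dX u) Etri :=
  (hu.fderiv_of_isOpen isOpen_Etri hmn).clm_apply contDiffOn_const

lemma smooth_dY {u : ℝ × ℝ → ℝ} {m n : WithTop ℕ∞} (hmn : m + 1 ≤ n) (hu : ContDiffOn ℝ n u Etri) :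
    ContDiffOn ℝ m (dY u) Etri :=
  (hu.fderiv_of_isOpen isOpen_Etri hmn).clm_apply contDiffOn_const

lemma diffAt_of {v : ℝ × ℝ → ℝ} {n : WithTop ℕ∞} (hn : n ≠ 0) (hv : ContDiffOn ℝ n v Etri)
    {p} (hp : p ∈ Etri) : DifferentiableAt ℝ v p :=
  (hv.contDiffAt (isOpen_Etri.mem_nhds hp)).differentiableAt hn

lemma deriv_x {v : ℝ × ℝ → ℝ} {p} (hv : DifferentiableAt ℝ v p) :
    deriv (fun x => v (x, p.2)) p.1 = dX v p := by
  have := scl_dx (r := 1) (v := v) (p := p) (by rwa [scl_one])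
  simp only [scl_one, one_mul] at this
  exact this.deriv

lemma deriv_y {v : ℝ × ℝ → ℝ} {p} (hv : DifferentiableAt ℝ v p) :
    deriv (fun y => v (p.1, y)) p.2 = dY v p := by
  have := scl_dy (r := 1) (v := v) (p := p) (by rwa [scl_one])
  simp only [scl_one, one_mul] at this
  exact this.deriv

lemma lap2_eq {u : ℝ × ℝ → ℝ} (hu : ContDiffOn ℝ 2 u Etri) {p} (hp : p ∈ Etri) :
    lap2 u p = dX (dX u) p + dY (dY u) p := by
  unfold lap2
  have ex1 : (deriv fun x => u (x, p.2)) =ᶠ[𝓝 p.1] fun x => dX u (x, p.2) := by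
    have : Tendsto (fun x : ℝ => (x, p.2)) (𝓝 p.1) (𝓝 p) :=
      (by fun_prop : Continuous (fun x : ℝ => (x, p.2))).tendsto p.1
    filter_upwards [this.eventually (isOpen_Etri.mem_nhds hp)] with x hx
    exact deriv_x (p := (x, p.2)) (diffAt_of (by norm_num) hu hx)
  have ey1 : (deriv fun y => u (p.1, y)) =ᶠ[𝓝 p.2] fun y => dY u (p.1, y) := by
    have : Tendsto (fun y : ℝ => (p.1, y)) (𝓝 p.2) (𝓝 p) :=
      (by fun_prop : Continuous (fun y : ℝ => (p.1, y))).tendsto p.2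
    filter_upwards [this.eventually (isOpen_Etri.mem_nhds hp)] with x hx
    exact deriv_y (p := (p.1, x)) (diffAt_of (by norm_num) hu hx)
  rw [ex1.deriv_eq, ey1.deriv_eq,
    deriv_x (diffAt_of one_ne_zero (smooth_dX (by norm_num) hu) hp),
    deriv_y (diffAt_of one_ne_zero (smooth_dY (by norm_num) hu) hp)]

lemma green_u {u : ℝ × ℝ → ℝ} (hu : ContDiffOn ℝ 2 u Etri) {lam : ℝ}
    (heq : ∀ p ∈ Etri, lap2 u p = -lam * u p) (a b c : ℤ) :
    ∃ M : ℝ, ∀ r : ℝ, 0 ≤ r → r < 1 → ∀ ε : ℝ, 0 ≤ ε →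
      (∀ p ∈ Ktri, p ∉ Etri → |u (scl r p)| ≤ ε) →
      ‖((r ^ 2 * lam - muq a b c : ℝ) : ℂ) * ∫ p in Ktri, u (scl r p) • lame a b c p‖
        ≤ 4 * ε * M := by
  obtain ⟨M1, hM1⟩ := isCompact_Ktri.exists_bound_of_continuousOn
    (continuous_wl (fun a b c => 1 * kA a b c) a b c).continuousOn
  obtain ⟨M2, hM2⟩ := isCompact_Ktri.exists_bound_of_continuousOn
    (continuous_wl (fun a b c => 1 * kB a b c) a b c).continuousOn
  refine ⟨max 0 (max M1 M2), ?_⟩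
  intro r h0 h1 ε hε hb
  have hmem : ∀ p ∈ Ktri, scl r p ∈ Etri := fun p hp => scl_mem h0 h1 hp
  have hcs : Continuous (scl r) := by unfold scl; fun_prop
  have huX := smooth_dX (m := 1) (by norm_num) hu
  have huY := smooth_dY (m := 1) (by norm_num) hu
  have huXX := smooth_dX (m := 0) (by norm_num) huX
  have huYY := smooth_dY (m := 0) (by norm_num) huY
  have G := green_bound (U := fun p => u (scl r p)) (Ux := fun p => r * dX u (scl r p))
    (Uxx := fun p => r * (r * dX (dX u) (scl r p)))
    (Uy := fun p => r * dY u (scl r p)) (Uyy := fun p => r * (r * dY (dY u) (scl r p)))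
    (W := lame a b c) (M := max 0 (max M1 M2)) hε (le_max_left _ _)
    (fun p hp => scl_dx (diffAt_of (by norm_num) hu (hmem p hp)))
    (fun p hp => (scl_dx (diffAt_of one_ne_zero huX (hmem p hp))).const_mul r)
    (fun p hp => scl_dy (diffAt_of (by norm_num) hu (hmem p hp)))
    (fun p hp => (scl_dy (diffAt_of one_ne_zero huY (hmem p hp))).const_mul r)
    (fun p _ => by rw [lame_eq_wl]; exact wl_dx _ a b c p)
    (fun p _ => wl_dx _ a b c p)
    (fun p _ => by rw [lame_eq_wl]; exact wl_dy _ a b c p)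
    (fun p _ => wl_dy _ a b c p)
    (hu.continuousOn.comp hcs.continuousOn hmem)
    (continuousOn_const.mul (continuousOn_const.mul (huXX.continuousOn.comp hcs.continuousOn hmem)))
    (continuousOn_const.mul (continuousOn_const.mul (huYY.continuousOn.comp hcs.continuousOn hmem)))
    (by rw [lame_eq_wl]; exact (continuous_wl _ a b c).continuousOn)
    (continuous_wl _ a b c).continuousOn (continuous_wl _ a b c).continuousOn
    (fun p hp h => lame_bdry a b c hp h) hb
    (fun p hp => (hM1 p hp).trans (le_max_of_le_right (le_max_left _ _)))
    (fun p hp => (hM2 p hp).trans (le_max_of_le_right (le_max_right _ _)))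
  convert G using 2
  rw [← integral_const_mul]
  refine setIntegral_congr_fun isClosed_Ktri.measurableSet (fun p hp => ?_)
  have e1 := lap2_eq hu (hmem p hp)
  rw [heq _ (hmem p hp)] at e1
  have e2 : r * (r * dX (dX u) (scl r p)) + r * (r * dY (dY u) (scl r p)) =
      - r ^ 2 * lam * u (scl r p) := by linear_combination (-r^2) * e1
  simp only [e2, lap_lame, Complex.real_smul]
  push_cast
  ring

lemma ortho {u : ℝ × ℝ → ℝ} (hc : ContinuousOn u Ktri) (hu : ContDiffOn ℝ 2 u Etri) {lam : ℝ}
    (hbd : ∀ p ∈ Ktri, p ∉ Etri → u p = 0)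
    (heq : ∀ p ∈ Etri, lap2 u p = -lam * u p) (a b c : ℤ) (hne : lam ≠ muq a b c) :
    ∫ p in Ktri, u p • lame a b c p = 0 := by
  obtain ⟨M, hM⟩ := green_u hu heq a b c
  obtain ⟨C, hC⟩ := isCompact_Ktri.exists_bound_of_continuousOn hc
  have cl : Continuous (lame a b c) := by rw [lame_eq_wl]; exact continuous_wl _ a b c
  obtain ⟨L, hL⟩ := isCompact_Ktri.exists_bound_of_continuousOn cl.continuousOn
  have hcs : ∀ r, Continuous (scl r) := fun r => by unfold scl; fun_prop
  have hmK := isClosed_Ktri.measurableSet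
  -- pointwise convergence
  have hpt : ∀ p ∈ Ktri, Tendsto (fun r => u (scl r p)) (𝓝[<] 1) (𝓝 (u p)) := by
    intro p hp
    refine (hc p hp).tendsto.comp (tendsto_nhdsWithin_iff.2 ⟨tendsto_scl p, ?_⟩)
    filter_upwards [ev_r] with r hr using Etri_sub_Ktri (scl_mem hr.1 hr.2 hp)
  have hI : Tendsto (fun r => ∫ p in Ktri, u (scl r p) • lame a b c p) (𝓝[<] 1)
      (𝓝 (∫ p in Ktri, u p • lame a b c p)) := by
    refine tendsto_integral_filter_of_dominated_convergence (fun _ => C * L) ?_ ?_ ?_ ?_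
    · filter_upwards [ev_r] with r hr
      refine ContinuousOn.aestronglyMeasurable ?_ hmK
      exact (hu.continuousOn.comp (hcs r).continuousOn
        (fun p hp => scl_mem hr.1 hr.2 hp)).smul cl.continuousOn
    · filter_upwards [ev_r] with r hr
      filter_upwards [ae_restrict_mem hmK] with p hp
      rw [norm_smul]
      have h1 := hC _ (Etri_sub_Ktri (scl_mem hr.1 hr.2 hp))
      exact mul_le_mul h1 (hL p hp) (norm_nonneg _) ((norm_nonneg _).trans h1)
    · have : IsFiniteMeasure (volume.restrict Ktri) :=
        ⟨by simpa using isCompact_Ktri.measure_lt_top⟩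
      exact integrable_const _
    · filter_upwards [ae_restrict_mem hmK] with p hp
      exact (hpt p hp).smul_const _
  -- uniform smallness on the boundary
  have hun : ∀ δ > 0, ∀ᶠ r in 𝓝[<] (1:ℝ), ∀ p ∈ Ktri, p ∉ Etri → |u (scl r p)| ≤ δ := by
    intro δ hδ
    have huc := isCompact_Ktri.uniformContinuousOn_of_continuous hc
    rw [Metric.uniformContinuousOn_iff] at huc
    obtain ⟨η, hη, H⟩ := huc δ hδ
    have : ∀ᶠ r in 𝓝[<] (1:ℝ), 1 - η < r :=
      (eventually_gt_nhds (by linarith : 1 - η < 1)).filter_mono nhdsWithin_le_nhds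
    filter_upwards [ev_r, this] with r hr hr2 p hp hpE
    have hd : dist (scl r p) p < η := by
      obtain ⟨b1, b2, b3, b4⟩ := Ktri_bounds hp
      have hs := s3pos
      have hsq := s3sq
      have hs2 : Real.sqrt 3 ≤ 2 := by nlinarith
      have hr1 : 0 ≤ 1 - r := by linarith [hr.2]
      rw [Prod.dist_eq, max_lt_iff, Real.dist_eq, Real.dist_eq]
      constructor
      · have : (scl r p).1 - p.1 = (1 - r) * (1 / 2 - p.1) := by simp only [scl]; ring
        rw [this, abs_mul, abs_of_nonneg hr1]
        have : |1 / 2 - p.1| ≤ 1 := abs_le.2 ⟨by linarith, by linarith⟩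
        nlinarith
      · have : (scl r p).2 - p.2 = (1 - r) * (Real.sqrt 3 / 6 - p.2) := by simp only [scl]; ring
        rw [this, abs_mul, abs_of_nonneg hr1]
        have : |Real.sqrt 3 / 6 - p.2| ≤ 1 := abs_le.2 ⟨by linarith, by linarith⟩
        nlinarith
    have := H _ (Etri_sub_Ktri (scl_mem hr.1 hr.2 hp)) _ hp hd
    rw [hbd p hp hpE, Real.dist_eq, sub_zero] at this
    exact this.le
  have hlim : Tendsto (fun r : ℝ => ‖((r ^ 2 * lam - muq a b c : ℝ) : ℂ) *
      ∫ p in Ktri, u (scl r p) • lame a b c p‖) (𝓝[<] 1)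
      (𝓝 ‖(((1:ℝ) ^ 2 * lam - muq a b c : ℝ) : ℂ) * ∫ p in Ktri, u p • lame a b c p‖) := by
    refine (Tendsto.mul ?_ hI).norm
    have : Continuous (fun r : ℝ => ((r ^ 2 * lam - muq a b c : ℝ) : ℂ)) := by fun_prop
    exact (this.tendsto 1).mono_left nhdsWithin_le_nhds
  have hle : ∀ δ > 0, ‖(((1:ℝ) ^ 2 * lam - muq a b c : ℝ) : ℂ) *
      ∫ p in Ktri, u p • lame a b c p‖ ≤ 4 * δ * M := by
    intro δ hδ
    refine le_of_tendsto hlim ?_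
    filter_upwards [ev_r, hun δ hδ] with r hr h
    exact hM r hr.1 hr.2 δ hδ.le h
  have h0 : ‖(((1:ℝ) ^ 2 * lam - muq a b c : ℝ) : ℂ) *
      ∫ p in Ktri, u p • lame a b c p‖ ≤ 0 := by
    have ht : Tendsto (fun δ : ℝ => 4 * δ * M) (𝓝[>] 0) (𝓝 (4 * 0 * M)) :=
      ((by fun_prop : Continuous (fun δ : ℝ => 4 * δ * M)).tendsto 0).mono_left nhdsWithin_le_nhds
    rw [mul_zero, zero_mul] at ht
    refine ge_of_tendsto ht ?_
    filter_upwards [self_mem_nhdsWithin] with δ hδ using hle δ hδ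
  have h1 := norm_le_zero_iff.1 h0
  rcases mul_eq_zero.1 h1 with h | h
  · exfalso
    have : (1:ℝ) ^ 2 * lam - muq a b c = 0 := by exact_mod_cast h
    apply hne; linarith
  · exact h

/-! ### completeness -/

lemma complete {u : ℝ × ℝ → ℝ} (hc : ContinuousOn u Ktri)
    (h : ∀ a b c : ℤ, ∫ p in Ktri, u p • lame a b c p = 0) : ∀ p ∈ Etri, u p = 0 := by
  have hmK := isClosed_Ktri.measurableSet
  have : CompactSpace Ktri := isCompact_iff_compactSpace.1 isCompact_Ktri
  let ν : Measure Ktri := Measure.comap (Subtype.val : Ktri → ℝ × ℝ) volume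
  have hfin : IsFiniteMeasure ν :=
    ⟨by
      rw [comap_subtype_coe_apply hmK, image_univ, Subtype.range_coe]
      exact isCompact_Ktri.measure_lt_top⟩
  have cl : ∀ a b c, Continuous (lame a b c) := fun a b c => by
    rw [lame_eq_wl]; exact continuous_wl _ a b c
  let uK : C(Ktri, ℂ) := ⟨fun p => (u p : ℂ), Complex.continuous_ofReal.comp hc.domRestrict⟩
  let lK : ℤ → ℤ → ℤ → C(Ktri, ℂ) := fun a b c => ⟨fun p => lame a b c p,
    (cl a b c).comp continuous_subtype_val⟩
  let zK : C(Ktri, ℂ) := ⟨fun p => zf p, continuous_zf.comp continuous_subtype_val⟩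
  have hint : ∀ f : C(Ktri, ℂ), Integrable f ν := fun f =>
    f.continuous.integrable_of_hasCompactSupport (HasCompactSupport.of_compactSpace _)
  let J : C(Ktri, ℂ) →ₗ[ℂ] ℂ :=
    { toFun := fun f => ∫ p, f p ∂ν
      map_add' := fun f g => integral_add (hint f) (hint g)
      map_smul' := fun k f => integral_const_mul k f }
  have hJ : ∀ a b c, J (uK * lK a b c) = 0 := by
    intro a b c
    have h1 := h a b c
    rw [← integral_subtype_comap hmK] at h1
    exact h1
  -- stable functions
  let S : Set C(Ktri, ℂ) := {q | ∀ a b c, J (uK * lK a b c * q) = 0}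
  have hz : ∀ f ∈ S, zK * f ∈ S := by
    intro f hf a b c
    have e : zK * lK a b c = lK (a+1) b c + lK a (b+1) c + lK a b (c+1) := by
      ext p; exact zf_mul_lame a b c p
    have : uK * lK a b c * (zK * f) = uK * lK (a+1) b c * f + uK * lK a (b+1) c * f +
        uK * lK a b (c+1) * f := by
      linear_combination (uK * f) * e
    rw [this, map_add, map_add, hf, hf, hf]; simp
  have hz' : ∀ f ∈ S, star zK * f ∈ S := by
    intro f hf a b c
    have e : star zK * lK a b c = lK (a-1) b c + lK a (b-1) c + lK a b (c-1) := by
      ext p; exact zfc_mul_lame a b c p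
    have : uK * lK a b c * (star zK * f) = uK * lK (a-1) b c * f + uK * lK a (b-1) c * f +
        uK * lK a b (c-1) * f := by
      linear_combination (uK * f) * e
    rw [this, map_add, map_add, hf, hf, hf]; simp
  have hadj : ∀ q ∈ StarAlgebra.adjoin ℂ {zK}, ∀ f ∈ S, q * f ∈ S := by
    intro q hq
    change q ∈ Algebra.adjoin ℂ ({zK} ∪ star {zK}) at hq
    induction hq using Algebra.adjoin_induction with
    | mem x hx =>
      rcases hx with hx | hx
      · rw [mem_singleton_iff] at hx; subst hx; exact hz
      · rw [Set.mem_star, mem_singleton_iff] at hx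
        have : x = star zK := by rw [← hx, star_star]
        subst this; exact hz'
    | algebraMap k =>
      intro f hf a b c
      have : uK * lK a b c * (algebraMap ℂ C(Ktri, ℂ) k * f) = k • (uK * lK a b c * f) := by
        rw [Algebra.smul_def]; ring
      rw [this, map_smul, hf, smul_zero]
    | add x y _ _ hx hy =>
      intro f hf a b c
      rw [add_mul, mul_add, map_add, hx f hf, hy f hf, add_zero]
    | mul x y _ _ hx hy =>
      intro f hf
      rw [mul_assoc]; exact hx _ (hy f hf)
  have hone : (1 : C(Ktri, ℂ)) ∈ S := by
    intro a b c; rw [mul_one]; exact hJ a b c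
  have hdense : (StarAlgebra.adjoin ℂ {zK}).topologicalClosure = ⊤ := by
    apply ContinuousMap.starSubalgebra_topologicalClosure_eq_top_of_separatesPoints
    intro p q hpq
    refine ⟨zK, ⟨zK, StarAlgebra.self_mem_adjoin_singleton ℂ zK, rfl⟩, ?_⟩
    intro hh
    exact hpq (Subtype.ext (zf_inj p.2 q.2 hh))
  set F : C(Ktri, ℂ) := uK * lK 0 1 2 with hF
  have hFz : J (F * star F) = 0 := by
    have hmem : star F ∈ (StarAlgebra.adjoin ℂ {zK}).topologicalClosure := by
      rw [hdense]; trivial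
    have hmem' : star F ∈ closure ((StarAlgebra.adjoin ℂ {zK} : StarSubalgebra ℂ C(Ktri, ℂ)) :
      Set C(Ktri, ℂ)) := hmem
    have hb : ∀ ε > 0, ‖J (F * star F)‖ ≤ ε * ∫ p, ‖F p‖ ∂ν := by
      intro ε hε
      obtain ⟨q, hq, hd⟩ := Metric.mem_closure_iff.1 hmem' ε hε
      have h0 : J (F * q) = 0 := by
        have := hadj q hq 1 hone 0 1 2
        rwa [mul_one] at this
      have : J (F * star F) = J (F * (star F - q)) := by rw [mul_sub, map_sub, h0, sub_zero]
      rw [this]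
      change ‖∫ p, (F * (star F - q)) p ∂ν‖ ≤ _
      rw [← integral_const_mul]
      refine norm_integral_le_of_norm_le ((hint F).norm.const_mul ε) (Eventually.of_forall ?_)
      intro p
      rw [ContinuousMap.mul_apply, norm_mul, mul_comm]
      gcongr
      refine (ContinuousMap.norm_coe_le_norm _ p).trans ?_
      rw [← dist_eq_norm]; exact hd.le
    have ht : Tendsto (fun ε : ℝ => ε * ∫ p, ‖F p‖ ∂ν) (𝓝[>] 0) (𝓝 (0 * ∫ p, ‖F p‖ ∂ν)) :=
      ((by fun_prop : Continuous (fun ε : ℝ => ε * ∫ p, ‖F p‖ ∂ν)).tendsto 0).mono_left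
        nhdsWithin_le_nhds
    rw [zero_mul] at ht
    have : ‖J (F * star F)‖ ≤ 0 := by
      refine ge_of_tendsto ht ?_
      filter_upwards [self_mem_nhdsWithin] with δ hδ using hb δ hδ
    exact norm_le_zero_iff.1 this
  have hsq : ∫ p : Ktri, ‖F p‖ ^ 2 ∂ν = 0 := by
    have : J (F * star F) = ((∫ p : Ktri, ‖F p‖ ^ 2 ∂ν : ℝ) : ℂ) := by
      rw [← integral_complex_ofReal]
      change ∫ p, (F * star F) p ∂ν = _
      congr 1
      ext1 p
      change F p * (starRingEnd ℂ) (F p) = _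
      rw [Complex.mul_conj, Complex.normSq_eq_norm_sq]
    rw [this] at hFz
    exact_mod_cast hFz
  have hsq' : ∫ p in Ktri, ‖(u p : ℂ) * lame 0 1 2 p‖ ^ 2 = 0 := by
    rw [← integral_subtype_comap hmK]; exact hsq
  have hcF : ContinuousOn (fun p => ‖(u p : ℂ) * lame 0 1 2 p‖ ^ 2) Ktri :=
    (((Complex.continuous_ofReal.comp_continuousOn hc).mul (cl 0 1 2).continuousOn).norm).pow 2
  rw [setIntegral_eq_zero_iff_of_nonneg_ae (Eventually.of_forall fun p => by positivity)
    (hcF.integrableOn_compact isCompact_Ktri)] at hsq'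
  have hae : (fun p => ‖(u p : ℂ) * lame 0 1 2 p‖ ^ 2) =ᵐ[volume.restrict Etri] 0 :=
    ae_restrict_of_ae_restrict_of_subset Etri_sub_Ktri hsq'
  have := Measure.eqOn_open_of_ae_eq hae isOpen_Etri (hcF.mono Etri_sub_Ktri) continuousOn_const
  intro p hp
  have hp0 := this hp
  simp only [Pi.zero_apply, pow_eq_zero_iff, ne_eq, OfNat.ofNat_ne_zero, not_false_eq_true,
    norm_eq_zero, mul_eq_zero, lame_rho_ne hp, or_false, Complex.ofReal_eq_zero] at hp0
  exact hp0

theorem stmt3 (lam : ℝ) (u : ℝ × ℝ → ℝ)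
    (hu_cont : ContinuousOn u (closure equilateralTriangle))
    (hu_smooth : ContDiffOn ℝ 2 u equilateralTriangle)
    (hu_bdry : ∀ p ∈ frontier equilateralTriangle, u p = 0)
    (hu_ne : ∃ p ∈ equilateralTriangle, u p ≠ 0)
    (hu_eq : ∀ p ∈ equilateralTriangle, lap2 u p = -lam * u p) :
    ∃ j k : ℕ, 0 < j ∧ 0 < k ∧
      lam = (4 * Real.pi / 3) ^ 2 * ((j : ℝ) ^ 2 + (k : ℝ) ^ 2 + j * k) := by
  rw [tri_eq] at *
  by_contra hno
  obtain ⟨p, hp, hne⟩ := hu_ne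
  apply hne
  have hc : ContinuousOn u Ktri := hu_cont.mono Ktri_sub_closure
  refine complete hc (fun a b c => ?_) p hp
  by_cases hd : a = b ∨ b = c ∨ a = c
  · simp [lame_degen hd]
  · refine ortho hc hu_smooth (fun p hp hE => hu_bdry p (bdry_sub ⟨hp, hE⟩)) hu_eq a b c ?_
    intro hl
    obtain ⟨j, k, hj, hk, e⟩ := exists_form hd
    exact hno ⟨j, k, hj, hk, hl.trans e⟩
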